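/- Let V be a finite set and E a finite set of unordered pairs {u,v} of distinct elements of V (a finite graph). Let J : E → ℝ satisfy J_e ≥ 0 for all e ∈ E and let λ : V → ℝ satisfy λ_v ≥ 0 for all v ∈ V. Define, for z ∈ ℂ, F(z) = ∫_{(−π,π]^V} exp( Σ_{{u,v}∈E} J_{{u,v}} cos(θ_u − θ_v) ) · exp( z Σ_{v∈V} λ_v cos θ_v ) ∏_{v∈V} dθ_v. Then F(z) ≠ 0 for every z ∈ ℂ with Re z ≠ 0. -/

import Mathlib

open MeasureTheory Real

/-- For a configuration of angles `θ : V → ℝ`, the symmetric function sending an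
unordered pair `{u, v}` to `cos (θ u - θ v)`. -/
noncomputable def xyEdgeCos {V : Type*} (θ : V → ℝ) : Sym2 V → ℝ :=
  Sym2.lift ⟨fun u v => Real.cos (θ u - θ v), fun u v => by
    show Real.cos (θ u - θ v) = Real.cos (θ v - θ u); rw [← Real.cos_neg, neg_sub]⟩

section ShiftOperator

open Filter Topology

variable {M K : Type*} [AddCommMonoid M] [Fintype K]

/-- The operator `f ↦ ∑ k, c k * f (· + ε k)` on functions on a commutative monoid. -/
noncomputable def shiftSum (c : K → ℂ) (ε : K → M) : Module.End ℂ (M → ℂ) where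
  toFun f p := ∑ k, c k * f (p + ε k)
  map_add' f g := by
    ext p
    simp [mul_add, Finset.sum_add_distrib]
  map_smul' a f := by
    ext p
    simp only [Pi.smul_apply, smul_eq_mul, RingHom.id_apply, Finset.mul_sum]
    exact Finset.sum_congr rfl fun k _ => by ring

/-- The value at `0` of the exponential of `shiftSum c ε` applied to `f`. -/
noncomputable def expShift (c : K → ℂ) (ε : K → M) (f : M → ℂ) : ℂ :=
  ∑' j : ℕ, (shiftSum c ε ^ j) f 0 / (j.factorial : ℂ)

lemma shiftSum_apply (c : K → ℂ) (ε : K → M) (f : M → ℂ) (p : M) :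
    shiftSum c ε f p = ∑ k, c k * f (p + ε k) := rfl

lemma shiftSum_pow_succ_apply (c : K → ℂ) (ε : K → M) (f : M → ℂ) (j : ℕ) (p : M) :
    (shiftSum c ε ^ (j + 1)) f p = ∑ k, c k * (shiftSum c ε ^ j) f (p + ε k) := by
  rw [pow_succ', Module.End.mul_apply, shiftSum_apply]

lemma norm_shiftSum_pow_le (c : K → ℂ) (ε : K → M) {f : M → ℂ} {C : ℝ}
    (hf : ∀ p, ‖f p‖ ≤ C) (j : ℕ) (p : M) :
    ‖(shiftSum c ε ^ j) f p‖ ≤ (∑ k, ‖c k‖) ^ j * C := by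
  induction j generalizing p with
  | zero => simpa using hf p
  | succ j ih =>
    rw [shiftSum_pow_succ_apply, pow_succ', mul_assoc, Finset.sum_mul]
    refine (norm_sum_le _ _).trans (Finset.sum_le_sum fun k _ => ?_)
    rw [norm_mul]
    exact mul_le_mul_of_nonneg_left (ih _) (norm_nonneg _)

lemma norm_expShift_term_le {c : K → ℂ} (ε : K → M) {f : M → ℂ} {B C : ℝ}
    (hc : ∑ k, ‖c k‖ ≤ B) (hf : ∀ p, ‖f p‖ ≤ C) (j : ℕ) :
    ‖(shiftSum c ε ^ j) f 0 / (j.factorial : ℂ)‖ ≤ B ^ j / j.factorial * C := by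
  have hC : 0 ≤ C := (norm_nonneg _).trans (hf 0)
  have hB : 0 ≤ ∑ k, ‖c k‖ := Finset.sum_nonneg fun _ _ => norm_nonneg _
  rw [norm_div, Complex.norm_natCast, div_mul_eq_mul_div]
  gcongr
  exact (norm_shiftSum_pow_le c ε hf j 0).trans (by gcongr)

lemma summable_pow_div_factorial_mul (B C : ℝ) :
    Summable fun j : ℕ => B ^ j / j.factorial * C :=
  (Real.summable_pow_div_factorial B).mul_right C

lemma summable_expShift (c : K → ℂ) (ε : K → M) {f : M → ℂ} {C : ℝ} (hf : ∀ p, ‖f p‖ ≤ C) :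
    Summable fun j : ℕ => (shiftSum c ε ^ j) f 0 / (j.factorial : ℂ) :=
  .of_norm_bounded (summable_pow_div_factorial_mul _ C) (norm_expShift_term_le ε le_rfl hf)

lemma expShift_add (c : K → ℂ) (ε : K → M) {f g : M → ℂ} {C D : ℝ}
    (hf : ∀ p, ‖f p‖ ≤ C) (hg : ∀ p, ‖g p‖ ≤ D) :
    expShift c ε (f + g) = expShift c ε f + expShift c ε g := by
  rw [expShift, expShift, expShift,
    ← (summable_expShift c ε hf).tsum_add (summable_expShift c ε hg)]
  simp [add_div]

lemma expShift_smul (c : K → ℂ) (ε : K → M) (a : ℂ) (f : M → ℂ) :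
    expShift c ε (a • f) = a * expShift c ε f := by
  rw [expShift, expShift, ← tsum_mul_left]
  simp [mul_div_assoc]

lemma expShift_sum {ι : Type*} (s : Finset ι) (c : K → ℂ) (ε : K → M) {f : ι → M → ℂ} {C : ι → ℝ}
    (hf : ∀ i p, ‖f i p‖ ≤ C i) :
    expShift c ε (∑ i ∈ s, f i) = ∑ i ∈ s, expShift c ε (f i) := by
  simp only [expShift]
  rw [← Summable.tsum_finsetSum fun i _ => summable_expShift c ε (hf i)]
  simp [Finset.sum_div]

lemma shiftSum_pow_character (c : K → ℂ) (ε : K → M) {f : M → ℂ}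
    (hf : ∀ p q, f (p + q) = f p * f q) (j : ℕ) (p : M) :
    (shiftSum c ε ^ j) f p = (∑ k, c k * f (ε k)) ^ j * f p := by
  induction j generalizing p with
  | zero => simp
  | succ j ih =>
    rw [shiftSum_pow_succ_apply, pow_succ', mul_assoc, Finset.sum_mul]
    exact Finset.sum_congr rfl fun k _ => by rw [ih, hf]; ring

lemma expShift_character (c : K → ℂ) (ε : K → M) {f : M → ℂ}
    (hf : ∀ p q, f (p + q) = f p * f q) (h0 : f 0 = 1) :
    expShift c ε f = Complex.exp (∑ k, c k * f (ε k)) := by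
  rw [expShift, Complex.exp_eq_exp_ℂ, NormedSpace.exp_eq_tsum_div]
  simp [shiftSum_pow_character c ε hf, h0]

lemma commute_shiftSum (c c' : K → ℂ) (ε : K → M) :
    Commute (shiftSum c ε) (shiftSum c' ε) := by
  refine LinearMap.ext fun f => funext fun p => ?_
  simp only [Module.End.mul_apply, shiftSum_apply, Finset.mul_sum]
  rw [Finset.sum_comm]
  refine Finset.sum_congr rfl fun k _ => Finset.sum_congr rfl fun l _ => ?_
  rw [add_right_comm]
  ring

lemma shiftSum_pow_succ_additive_mul (c : K → ℂ) (ε : K → M) (d : M →+ ℂ) (f : M → ℂ) (j : ℕ) :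
    (shiftSum c ε ^ (j + 1)) (d * f) = d * (shiftSum c ε ^ (j + 1)) f +
      ((j : ℂ) + 1) • (shiftSum c ε ^ j) (shiftSum (fun k => c k * d (ε k)) ε f) := by
  have key : ∀ g : M → ℂ, shiftSum c ε (d * g) =
      d * shiftSum c ε g + shiftSum (fun k => c k * d (ε k)) ε g := by
    intro g
    ext p
    simp only [shiftSum_apply, Pi.mul_apply, Pi.add_apply, map_add, Finset.mul_sum,
      ← Finset.sum_add_distrib]
    exact Finset.sum_congr rfl fun k _ => by ring
  induction j with
  | zero => simpa using key f
  | succ j ih =>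
    have hcomm := (commute_shiftSum c (fun k => c k * d (ε k)) ε).pow_left (j + 1)
    have h1 : shiftSum (fun k => c k * d (ε k)) ε ((shiftSum c ε ^ (j + 1)) f) =
        (shiftSum c ε ^ (j + 1)) (shiftSum (fun k => c k * d (ε k)) ε f) := by
      rw [← Module.End.mul_apply, ← hcomm.eq, Module.End.mul_apply]
    have h2 : ∀ (n : ℕ) (g : M → ℂ),
        (shiftSum c ε ^ (n + 1)) g = shiftSum c ε ((shiftSum c ε ^ n) g) := fun n g => by
      rw [pow_succ', Module.End.mul_apply]
    rw [h2 (j + 1), ih, map_add, key, map_smul, h1, ← h2, ← h2, add_assoc]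
    congr 1
    push_cast
    module

/-- Multiplication by an additive function acts as a derivation on `expShift`. -/
lemma expShift_additive_mul (c : K → ℂ) (ε : K → M) (d : M →+ ℂ) {f : M → ℂ} {C : ℝ}
    (hf : ∀ p, ‖f p‖ ≤ C) :
    expShift c ε (d * f) = expShift c ε (shiftSum (fun k => c k * d (ε k)) ε f) := by
  have hterm : ∀ j : ℕ, (shiftSum c ε ^ (j + 1)) (d * f) 0 / ((j + 1).factorial : ℂ) =
      (shiftSum c ε ^ j) (shiftSum (fun k => c k * d (ε k)) ε f) 0 / (j.factorial : ℂ) := by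
    intro j
    have : (j.factorial : ℂ) ≠ 0 := by exact_mod_cast j.factorial_ne_zero
    have : (j : ℂ) + 1 ≠ 0 := by exact_mod_cast j.succ_ne_zero
    rw [shiftSum_pow_succ_additive_mul]
    simp only [Pi.add_apply, Pi.mul_apply, map_zero, zero_mul, zero_add, Pi.smul_apply,
      smul_eq_mul, Nat.factorial_succ]
    push_cast
    field_simp
  have hs := summable_expShift c ε
    (norm_shiftSum_pow_le (fun k => c k * d (ε k)) ε hf 1)
  rw [pow_one] at hs
  rw [expShift, Summable.tsum_eq_zero_add]
  · simp [hterm, expShift]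
  · exact (summable_nat_add_iff 1).1 (by simpa only [hterm] using hs)

lemma expShift_sign_mul (c : K → ℂ) (ε : K → M) {σ : M → ℂ}
    (hσ : ∀ p q, σ (p + q) = σ p * σ q) (h0 : σ 0 = 1) (f : M → ℂ) :
    expShift c ε (σ * f) = expShift (fun k => σ (ε k) * c k) ε f := by
  have key : ∀ (j : ℕ) (p : M), (shiftSum c ε ^ j) (σ * f) p =
      σ p * (shiftSum (fun k => σ (ε k) * c k) ε ^ j) f p := by
    intro j
    induction j with
    | zero => simp
    | succ j ih =>
      intro p
      simp only [shiftSum_pow_succ_apply, ih, hσ, Finset.mul_sum]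
      exact Finset.sum_congr rfl fun k _ => by ring
  simp [expShift, key, h0]

lemma tendsto_expShift {ι : Type*} {l : Filter ι} {c : ι → K → ℂ} {c₀ : K → ℂ} (ε : K → M)
    {f : ι → M → ℂ} {f₀ : M → ℂ} {C : ℝ} (hc : ∀ k, Tendsto (fun i => c i k) l (𝓝 (c₀ k)))
    (hf : ∀ p, Tendsto (fun i => f i p) l (𝓝 (f₀ p))) (hC : ∀ᶠ i in l, ∀ p, ‖f i p‖ ≤ C) :
    Tendsto (fun i => expShift (c i) ε (f i)) l (𝓝 (expShift c₀ ε f₀)) := by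
  have hpow : ∀ (j : ℕ) (p : M), Tendsto (fun i => (shiftSum (c i) ε ^ j) (f i) p) l
      (𝓝 ((shiftSum c₀ ε ^ j) f₀ p)) := by
    intro j
    induction j with
    | zero => simpa using hf
    | succ j ih =>
      intro p
      simp only [shiftSum_pow_succ_apply]
      exact tendsto_finsetSum _ fun k _ => (hc k).mul (ih _)
  have hsum : Tendsto (fun i => ∑ k, ‖c i k‖) l (𝓝 (∑ k, ‖c₀ k‖)) :=
    tendsto_finsetSum _ fun k _ => (hc k).norm
  refine tendsto_tsum_of_dominated_convergence
    (summable_pow_div_factorial_mul (∑ k, ‖c₀ k‖ + 1) C) (fun j => (hpow j 0).div_const _) ?_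
  filter_upwards [hC, hsum.eventually_le_const (lt_add_one _)] with i hi hi'
  exact norm_expShift_term_le ε hi' hi

lemma differentiable_expShift {c : ℂ → K → ℂ} (ε : K → M) {f : M → ℂ} {C : ℝ}
    (hc : ∀ k, Differentiable ℂ fun z => c z k) (hf : ∀ p, ‖f p‖ ≤ C) :
    Differentiable ℂ fun z => expShift (c z) ε f := by
  have hpow : ∀ (j : ℕ) (p : M), Differentiable ℂ fun z => (shiftSum (c z) ε ^ j) f p := by
    intro j
    induction j with
    | zero => simp
    | succ j ih =>
      intro p
      simp only [shiftSum_pow_succ_apply]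
      exact Differentiable.fun_sum fun k _ => (hc k).mul (ih _)
  intro z₀
  have hcont : Continuous fun z => ∑ k, ‖c z k‖ :=
    continuous_finsetSum _ fun k _ => (hc k).continuous.norm
  have hopen : IsOpen {z | ∑ k, ‖c z k‖ < ∑ k, ‖c z₀ k‖ + 1} :=
    isOpen_lt hcont continuous_const
  refine DifferentiableOn.differentiableAt (Complex.differentiableOn_tsum_of_summable_norm
    (summable_pow_div_factorial_mul (∑ k, ‖c z₀ k‖ + 1) C)
    (fun j => ((hpow j 0).div_const _).differentiableOn) hopen
    fun j z hz => norm_expShift_term_le ε (le_of_lt hz) hf j) (hopen.mem_nhds ?_)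
  exact lt_add_one (∑ k, ‖c z₀ k‖)

lemma integral_expShift {Ω : Type*} [MeasurableSpace Ω] (μ : Measure Ω) [IsFiniteMeasure μ]
    (c : K → ℂ) (ε : K → M) {f : Ω → M → ℂ} {C : ℝ}
    (hm : ∀ p, Integrable (fun ω => f ω p) μ) (hf : ∀ ω p, ‖f ω p‖ ≤ C) :
    ∫ ω, expShift c ε (f ω) ∂μ = expShift c ε fun p => ∫ ω, f ω p ∂μ := by
  have hpow : ∀ (j : ℕ) (p : M), Integrable (fun ω => (shiftSum c ε ^ j) (f ω) p) μ ∧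
      ∫ ω, (shiftSum c ε ^ j) (f ω) p ∂μ =
        (shiftSum c ε ^ j) (fun p => ∫ ω, f ω p ∂μ) p := by
    intro j
    induction j with
    | zero => simpa using hm
    | succ j ih =>
      intro p
      simp only [shiftSum_pow_succ_apply]
      refine ⟨integrable_finsetSum _ fun k _ => (ih _).1.const_mul _, ?_⟩
      rw [integral_finsetSum _ fun k _ => (ih _).1.const_mul _]
      exact Finset.sum_congr rfl fun k _ => by rw [integral_const_mul, (ih _).2]
  simp only [expShift]
  rw [← integral_tsum_of_summable_integral_norm]
  · exact tsum_congr fun j => by rw [integral_div, (hpow j 0).2]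
  · exact fun j => (hpow j 0).1.div_const _
  · refine Summable.of_nonneg_of_le (fun j => integral_nonneg fun _ => norm_nonneg _) (fun j => ?_)
      ((summable_pow_div_factorial_mul (∑ k, ‖c k‖) C).mul_right (μ.real Set.univ))
    refine (Real.le_norm_self _).trans (norm_integral_le_of_norm_le_const (.of_forall fun ω => ?_))
    rw [norm_norm]
    exact norm_expShift_term_le ε le_rfl (hf ω) j

end ShiftOperator

open Filter Topology in
/-- Hurwitz's theorem: a limit of zero-free holomorphic functions is zero-free or vanishes
identically. -/
lemma ne_zero_of_tendstoLocallyUniformlyOn {U : Set ℂ} (hU : IsOpen U) (hUc : IsPreconnected U)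
    {F : ℕ → ℂ → ℂ} {f : ℂ → ℂ} (hF : ∀ᶠ n in atTop, DifferentiableOn ℂ (F n) U)
    (hlim : TendstoLocallyUniformlyOn F f atTop U)
    (hne : ∀ᶠ n in atTop, ∀ z ∈ U, F n z ≠ 0) {x : ℂ} (hx : x ∈ U) (hfx : f x ≠ 0)
    {z : ℂ} (hz : z ∈ U) : f z ≠ 0 := by
  intro hfz
  have hfd : DifferentiableOn ℂ f U := hlim.differentiableOn hF hU
  have hfa : AnalyticOnNhd ℂ f U := hfd.analyticOnNhd hU
  have hiso : ∀ᶠ w in 𝓝[≠] z, f w ≠ 0 := by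
    refine (hfa z hz).eventually_eq_zero_or_eventually_ne_zero.resolve_left fun h => hfx ?_
    exact hfa.eqOn_zero_of_preconnected_of_eventuallyEq_zero hUc hz h hx
  obtain ⟨r, hr, hball⟩ := Metric.eventually_nhds_iff_ball.1
    ((eventually_nhdsWithin_iff.1 hiso).and (hU.mem_nhds hz))
  have hr2 : 0 < r / 2 := half_pos hr
  have hsub : Metric.closedBall z (r / 2) ⊆ Metric.ball z r :=
    Metric.closedBall_subset_ball (half_lt_self hr)
  have hsubU : Metric.closedBall z (r / 2) ⊆ U := fun w hw => (hball w (hsub hw)).2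
  have hKU : Metric.sphere z (r / 2) ⊆ U := Metric.sphere_subset_closedBall.trans hsubU
  have hunif := (tendstoLocallyUniformlyOn_iff_forall_isCompact hU).1 hlim _ hsubU
    (isCompact_closedBall z (r / 2))
  obtain ⟨w₀, hw₀, hmin⟩ := (isCompact_sphere z (r / 2)).exists_isMinOn
    (NormedSpace.sphere_nonempty.2 hr2.le) (hfd.continuousOn.norm.mono hKU)
  have hδ : 0 < ‖f w₀‖ := norm_pos_iff.2 <| (hball w₀ (hsub (Metric.sphere_subset_closedBall hw₀))).1
    (Metric.ne_of_mem_sphere hw₀ hr2.ne')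
  obtain ⟨n, hn, hnd, hnz⟩ :=
    ((Metric.tendstoUniformlyOn_iff.1 hunif (‖f w₀‖ / 2) (half_pos hδ)).and (hF.and hne)).exists
  have hsphere : ∀ w ∈ frontier (Metric.ball z (r / 2)), ‖(F n w)⁻¹‖ ≤ (‖f w₀‖ / 2)⁻¹ := by
    intro w hw
    rw [frontier_ball z hr2.ne'] at hw
    have h1 : ‖f w₀‖ ≤ ‖f w‖ := hmin hw
    have h2 := hn w (Metric.sphere_subset_closedBall hw)
    rw [dist_eq_norm] at h2
    have h3 := norm_sub_norm_le (f w) (F n w)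
    rw [norm_inv]
    exact inv_anti₀ (half_pos hδ) (by linarith)
  have hdiff : DiffContOnCl ℂ (fun w => (F n w)⁻¹) (Metric.ball z (r / 2)) := by
    refine DifferentiableOn.diffContOnCl ?_
    rw [closure_ball z hr2.ne']
    exact (hnd.mono hsubU).inv fun w hw => hnz w (hsubU hw)
  have hmax := Complex.norm_le_of_forall_mem_frontier_norm_le Metric.isBounded_ball hdiff hsphere
    (subset_closure (Metric.mem_ball_self hr2))
  have hzn := hn z (Metric.mem_closedBall_self hr2.le)
  rw [hfz, dist_zero_left] at hzn
  rw [norm_inv] at hmax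
  have := (inv_le_inv₀ (norm_pos_iff.2 (hnz z hz)) (half_pos hδ)).1 hmax
  linarith

/-- The Heilmann–Lieb theorem for families satisfying the monomer-dimer recursion. -/
lemma monomer_dimer_ne_zero {S : Type*} [Fintype S] [DecidableEq S] {Z : (S → ℕ) → ℂ} {x : S → ℂ}
    {w : S → S → ℝ} (hx : ∀ s, 0 < (x s).re) (hw : ∀ s t, 0 ≤ w s t) (h0 : Z 0 ≠ 0)
    (hrec : ∀ m s, Z (m + Pi.single s 1) =
      x s * Z m + ∑ t, (w s t * m t : ℂ) * Z (m - Pi.single t 1)) (m : S → ℕ) : Z m ≠ 0 := by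
  have hdecomp : ∀ (m : S → ℕ) (s : S), m s ≠ 0 → m - Pi.single s 1 + Pi.single s 1 = m := by
    intro m s hs
    ext t
    rcases eq_or_ne t s with rfl | ht
    · simp only [Pi.add_apply, Pi.sub_apply, Pi.single_eq_same]
      omega
    · simp [ht]
  have hlt : ∀ (m : S → ℕ) (s : S), m s ≠ 0 → ∑ t, (m - Pi.single s 1 : S → ℕ) t < ∑ t, m t := by
    intro m s hs
    conv_rhs => rw [← hdecomp m s hs]
    simp [Finset.sum_add_distrib]
  suffices H : ∀ (n : ℕ) (m : S → ℕ), ∑ t, m t = n →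
      Z m ≠ 0 ∧ ∀ s, 0 < (Z (m + Pi.single s 1) / Z m).re from (H _ m rfl).1
  intro n
  induction n using Nat.strong_induction_on with
  | _ n ih =>
    rintro m rfl
    have hm : Z m ≠ 0 := by
      by_cases h : ∃ s, m s ≠ 0
      · obtain ⟨s, hs⟩ := h
        have h1 := (ih _ (hlt m s hs) _ rfl).2 s
        rw [hdecomp m s hs] at h1
        intro h2
        simp [h2] at h1
      · push Not at h
        rwa [show m = 0 from funext h]
    refine ⟨hm, fun s => ?_⟩
    rw [hrec, add_div, mul_div_cancel_right₀ _ hm, Finset.sum_div, Complex.add_re, Complex.re_sum]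
    refine add_pos_of_pos_of_nonneg (hx s) (Finset.sum_nonneg fun t _ => ?_)
    by_cases ht : m t = 0
    · simp [ht]
    have h1 := (ih _ (hlt m t ht) _ rfl).2 t
    rw [hdecomp m t ht] at h1
    have h2 : 0 ≤ (Z (m - Pi.single t 1) / Z m).re := by
      rw [← inv_div, Complex.inv_re]
      exact div_nonneg h1.le (Complex.normSq_nonneg _)
    rw [mul_div_assoc, show (w s t * m t : ℂ) = ((w s t * m t : ℝ) : ℂ) by push_cast; rfl,
      Complex.re_ofReal_mul]
    exact mul_nonneg (mul_nonneg (hw s t) (Nat.cast_nonneg _)) h2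

section MonomerDimer

open Filter Topology

/-- The weighted number of ways to remove `p` of `m` points and `q` of `n` points in order and to
match the remaining points of the two families perfectly, each pair having weight `W`. -/
noncomputable def pairWeight (W : ℝ) (m n p q : ℕ) : ℂ :=
  if p ≤ m ∧ m + q = n + p then
    (m.factorial : ℂ) * n.factorial * W ^ (m - p) / (m - p).factorial else 0

lemma pairWeight_comm (W : ℝ) (m n p q : ℕ) : pairWeight W m n p q = pairWeight W n m q p := by
  unfold pairWeight
  by_cases h : p ≤ m ∧ m + q = n + p
  · rw [if_pos h, if_pos (by omega), show n - q = m - p by omega]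
    ring
  · rw [if_neg h, if_neg (by omega)]

lemma pairWeight_succ_removed (W : ℝ) (m n p q : ℕ) :
    pairWeight W m n (p + 1) q = m * pairWeight W (m - 1) n p q := by
  unfold pairWeight
  rcases m with _ | m
  · simp
  by_cases h : p + 1 ≤ m + 1 ∧ m + 1 + q = n + (p + 1)
  · rw [if_pos h, if_pos (by omega), Nat.add_sub_add_right, Nat.add_sub_cancel, Nat.factorial_succ]
    push_cast
    ring
  · rw [if_neg h, if_neg (by omega), mul_zero]

lemma pairWeight_succ_points (W : ℝ) (m n p q : ℕ) :
    pairWeight W (m + 1) n p q =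
      p * pairWeight W m n (p - 1) q + W * n * pairWeight W m (n - 1) p q := by
  unfold pairWeight
  by_cases h : p ≤ m + 1 ∧ m + 1 + q = n + p
  · rw [if_pos h]
    obtain ⟨d, hd⟩ : ∃ d, m + 1 = p + d := ⟨m + 1 - p, by omega⟩
    have hd' : m + 1 - p = d := by omega
    have key : ((m : ℂ) + 1) = p + d := by exact_mod_cast hd
    rcases p with _ | p
    · rcases n with _ | n
      · omega
      obtain rfl : d = m + 1 := by omega
      have : ((m + 1).factorial : ℂ) ≠ 0 := by exact_mod_cast (m + 1).factorial_ne_zero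
      have : (m.factorial : ℂ) ≠ 0 := by exact_mod_cast m.factorial_ne_zero
      rw [if_pos (⟨by omega, by omega⟩ : 0 ≤ m ∧ m + q = n + 1 - 1 + 0)]
      simp only [Nat.sub_zero, Nat.add_sub_cancel, Nat.factorial_succ n]
      push_cast
      field_simp
      ring
    · rw [if_pos (⟨by omega, by omega⟩ : p + 1 - 1 ≤ m ∧ m + q = n + (p + 1 - 1))]
      rcases d with _ | d
      · rw [if_neg (by omega), hd', show m - (p + 1 - 1) = 0 by omega, Nat.factorial_succ]
        obtain rfl : m = p := by omega
        push_cast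
        ring
      · have hn : 0 < n ∨ n = 0 := by omega
        have : ((d + 1).factorial : ℂ) ≠ 0 := by exact_mod_cast (d + 1).factorial_ne_zero
        have : (d.factorial : ℂ) ≠ 0 := by exact_mod_cast d.factorial_ne_zero
        have hdd : ((d : ℂ) + 1) ≠ 0 := by exact_mod_cast d.succ_ne_zero
        rcases n with _ | n
        · omega
        rw [if_pos (⟨by omega, by omega⟩ : p + 1 ≤ m ∧ m + q = n + 1 - 1 + (p + 1)), hd',
          show m - (p + 1 - 1) = d + 1 by omega, show m - (p + 1) = d by omega,
          Nat.add_sub_cancel, Nat.factorial_succ m, Nat.factorial_succ n, Nat.factorial_succ d]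
        push_cast at key ⊢
        rw [key]
        field_simp
        ring
  · rw [if_neg h]
    rcases Nat.eq_zero_or_pos p with hp | hp
    · rcases Nat.eq_zero_or_pos n with hn | hn
      · simp [hp, hn]
      · rw [if_neg (by omega : ¬ (p ≤ m ∧ m + q = n - 1 + p))]
        simp [hp]
    · rw [if_neg (by omega : ¬ (p - 1 ≤ m ∧ m + q = n + (p - 1)))]
      rcases Nat.eq_zero_or_pos n with hn | hn
      · simp [hn]
      · rw [if_neg (by omega : ¬ (p ≤ m ∧ m + q = n - 1 + p))]
        simp

lemma norm_pairWeight_le (W : ℝ) (m n p q : ℕ) :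
    ‖pairWeight W m n p q‖ ≤
      ∑ d ∈ Finset.range (m + 1), (m.factorial : ℝ) * n.factorial * |W| ^ d := by
  have hnn : ∀ d ∈ Finset.range (m + 1), 0 ≤ (m.factorial : ℝ) * n.factorial * |W| ^ d :=
    fun d _ => by positivity
  unfold pairWeight
  split_ifs with h
  · refine le_trans ?_ (Finset.single_le_sum hnn (Finset.mem_range.2 (by omega : m - p < m + 1)))
    simp only [norm_div, norm_mul, norm_pow, Complex.norm_natCast, Complex.norm_real,
      Real.norm_eq_abs]
    exact div_le_self (by positivity) (by exact_mod_cast (m - p).factorial_pos)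
  · simpa using Finset.sum_nonneg hnn

lemma pairWeight_div_self {N : ℕ} (hN : N ≠ 0) (p q : ℕ) :
    pairWeight N N N p q / (N.factorial * (N : ℂ) ^ N) =
      if p = q then ((N.descFactorial p / (N : ℝ) ^ p : ℝ) : ℂ) else 0 := by
  have hN' : (N : ℂ) ≠ 0 := by exact_mod_cast hN
  have hf : (N.factorial : ℂ) ≠ 0 := by exact_mod_cast N.factorial_ne_zero
  unfold pairWeight
  by_cases hpq : p = q
  · subst hpq
    by_cases hp : p ≤ N
    · have hf' : ((N - p).factorial : ℂ) ≠ 0 := by exact_mod_cast (N - p).factorial_ne_zero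
      have h1 : ((N - p).factorial : ℂ) * N.descFactorial p = N.factorial := by
        exact_mod_cast Nat.factorial_mul_descFactorial hp
      have h2 : (N : ℂ) ^ N = N ^ (N - p) * N ^ p := by rw [← pow_add, Nat.sub_add_cancel hp]
      rw [if_pos ⟨hp, rfl⟩, if_pos rfl, h2]
      push_cast
      field_simp
      rw [← h1, mul_comm]
    · rw [if_neg (by omega), Nat.descFactorial_eq_zero_iff_lt.2 (by omega)]
      simp
  · rw [if_neg (by omega), if_neg hpq, zero_div]

lemma tendsto_descFactorial_div_pow (p : ℕ) :
    Tendsto (fun N : ℕ => (N.descFactorial p : ℝ) / (N : ℝ) ^ p) atTop (𝓝 1) := by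
  refine (Asymptotics.isEquivalent_iff_tendsto_one ?_).1 (isEquivalent_descFactorial p)
  filter_upwards [eventually_ne_atTop 0] with N hN
  positivity

variable {V : Type*} [Fintype V] [DecidableEq V]

/-- The product over `v` of the pair weights of the two families of points attached to `v`. -/
noncomputable def siteWeight (W : ℝ) (m p : V × Bool → ℕ) : ℂ :=
  ∏ v, pairWeight W (m (v, true)) (m (v, false)) (p (v, true)) (p (v, false))

lemma siteWeight_eq_mul (W : ℝ) (m p : V × Bool → ℕ) (v : V) (b : Bool) :
    siteWeight W m p = pairWeight W (m (v, b)) (m (v, !b)) (p (v, b)) (p (v, !b)) *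
      ∏ u ∈ Finset.univ.erase v,
        pairWeight W (m (u, true)) (m (u, false)) (p (u, true)) (p (u, false)) := by
  rw [siteWeight, ← Finset.mul_prod_erase _ _ (Finset.mem_univ v)]
  cases b
  · rw [pairWeight_comm]
    rfl
  · rfl

lemma siteWeight_add_single (W : ℝ) (m p : V × Bool → ℕ) (s : V × Bool) :
    siteWeight W m (p + Pi.single s 1) = m s * siteWeight W (m - Pi.single s 1) p := by
  obtain ⟨v, b⟩ := s
  rw [siteWeight_eq_mul W m _ v b, siteWeight_eq_mul W (m - _) p v b, ← mul_assoc]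
  congr 1
  · have : ((v, !b) : V × Bool) ≠ (v, b) := by simp
    simpa [this] using pairWeight_succ_removed W (m (v, b)) (m (v, !b)) (p (v, b)) (p (v, !b))
  · refine Finset.prod_congr rfl fun u hu => ?_
    have : ∀ c, ((u, c) : V × Bool) ≠ (v, b) := fun c h =>
      Finset.ne_of_mem_erase hu (Prod.ext_iff.1 h).1
    simp [this]

lemma siteWeight_add_single_points (W : ℝ) (m p : V × Bool → ℕ) (s : V × Bool) :
    siteWeight W (m + Pi.single s 1) p = p s * siteWeight W m (p - Pi.single s 1) +
      W * m (s.1, !s.2) * siteWeight W (m - Pi.single (s.1, !s.2) 1) p := by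
  obtain ⟨v, b⟩ := s
  have hoff : ∀ u ∈ Finset.univ.erase v, ∀ c c', ((u, c) : V × Bool) ≠ (v, c') :=
    fun u hu c c' h => Finset.ne_of_mem_erase hu (Prod.ext_iff.1 h).1
  have h1 : ((v, !b) : V × Bool) ≠ (v, b) := by simp
  rw [siteWeight_eq_mul W (m + _) p v b, siteWeight_eq_mul W m _ v b,
    siteWeight_eq_mul W (m - _) p v b, ← mul_assoc, ← mul_assoc]
  have e1 : ∏ u ∈ Finset.univ.erase v, pairWeight W
      ((m + Pi.single (v, b) 1 : V × Bool → ℕ) (u, true))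
      ((m + Pi.single (v, b) 1 : V × Bool → ℕ) (u, false)) (p (u, true)) (p (u, false)) =
      ∏ u ∈ Finset.univ.erase v,
        pairWeight W (m (u, true)) (m (u, false)) (p (u, true)) (p (u, false)) :=
    Finset.prod_congr rfl fun u hu => by simp [hoff u hu]
  have e2 : ∏ u ∈ Finset.univ.erase v, pairWeight W (m (u, true)) (m (u, false))
      ((p - Pi.single (v, b) 1 : V × Bool → ℕ) (u, true))
      ((p - Pi.single (v, b) 1 : V × Bool → ℕ) (u, false)) =
      ∏ u ∈ Finset.univ.erase v,
        pairWeight W (m (u, true)) (m (u, false)) (p (u, true)) (p (u, false)) :=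
    Finset.prod_congr rfl fun u hu => by simp [hoff u hu]
  have e3 : ∏ u ∈ Finset.univ.erase v,
      pairWeight W ((m - Pi.single (v, !b) 1 : V × Bool → ℕ) (u, true))
      ((m - Pi.single (v, !b) 1 : V × Bool → ℕ) (u, false)) (p (u, true)) (p (u, false)) =
      ∏ u ∈ Finset.univ.erase v,
        pairWeight W (m (u, true)) (m (u, false)) (p (u, true)) (p (u, false)) :=
    Finset.prod_congr rfl fun u hu => by simp [hoff u hu]
  rw [e1, e2, e3, ← add_mul]
  congr 1
  simpa [h1, h1.symm] using
    pairWeight_succ_points W (m (v, b)) (m (v, !b)) (p (v, b)) (p (v, !b))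

omit [DecidableEq V] in
lemma exists_norm_siteWeight_le (W : ℝ) (m : V × Bool → ℕ) :
    ∃ C : ℝ, ∀ p, ‖siteWeight W m p‖ ≤ C := by
  refine ⟨∏ v, ∑ d ∈ Finset.range (m (v, true) + 1),
    ((m (v, true)).factorial : ℝ) * (m (v, false)).factorial * |W| ^ d, fun p => ?_⟩
  rw [siteWeight, norm_prod]
  exact Finset.prod_le_prod (fun _ _ => norm_nonneg _) fun v _ => norm_pairWeight_le W _ _ _ _

omit [DecidableEq V] in
lemma siteWeight_zero (W : ℝ) (p : V × Bool → ℕ) :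
    siteWeight W 0 p = if p = 0 then 1 else 0 := by
  split_ifs with h
  · simp [siteWeight, pairWeight, h]
  · obtain ⟨⟨v, b⟩, hv⟩ := Function.ne_iff.1 h
    refine Finset.prod_eq_zero (Finset.mem_univ v) (if_neg ?_)
    rintro ⟨h1, h2⟩
    simp only [Pi.zero_apply] at h1 h2 hv
    cases b <;> omega

section Steps

variable {S : Type*} [DecidableEq S]

/-- The exponents of the monomials of a quadratic form without constant term. -/
def monomerDimerStep : S ⊕ S × S → S → ℕ :=
  Sum.elim (fun s => Pi.single s 1) fun e => Pi.single e.1 1 + Pi.single e.2 1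

/-- The coefficients of the quadratic form `∑ s, x s X_s + 1/2 ∑ s t, w s t X_s X_t`. -/
noncomputable def monomerDimerCoeff (x : S → ℂ) (w : S → S → ℝ) : S ⊕ S × S → ℂ :=
  Sum.elim x fun e => (w e.1 e.2 : ℂ) / 2

lemma expShift_pi_single_mul [Fintype S] (x : S → ℂ) {w : S → S → ℝ}
    (hw : ∀ s t, w s t = w t s) (s : S) {f : (S → ℕ) → ℂ} {C : ℝ} (hf : ∀ p, ‖f p‖ ≤ C) :
    expShift (monomerDimerCoeff x w) monomerDimerStep
        (fun p => (p s : ℂ) * f (p - Pi.single s 1)) =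
      x s * expShift (monomerDimerCoeff x w) monomerDimerStep f +
        ∑ t, (w s t : ℂ) * expShift (monomerDimerCoeff x w) monomerDimerStep
          (fun p : S → ℕ => f (p + Pi.single t 1)) := by
  have hder := expShift_additive_mul (monomerDimerCoeff x w) monomerDimerStep
    ((Nat.castAddMonoidHom ℂ).comp (Pi.evalAddMonoidHom (fun _ : S => ℕ) s))
    (f := fun p => f (p - Pi.single s 1)) fun p => hf _
  have hfun : shiftSum (fun k => monomerDimerCoeff x w k *
        (Nat.castAddMonoidHom ℂ).comp (Pi.evalAddMonoidHom (fun _ : S => ℕ) s)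
          (monomerDimerStep k)) monomerDimerStep (fun p => f (p - Pi.single s 1)) =
      x s • f + ∑ t, (w s t : ℂ) • fun p : S → ℕ => f (p + Pi.single t 1) := by
    ext p
    have h1 : ∀ t, p + (Pi.single s 1 + Pi.single t 1) - Pi.single s 1 = p + Pi.single t 1 := by
      intro t
      rw [add_left_comm, add_tsub_cancel_left]
    have h2 : ∀ t, p + (Pi.single t 1 + Pi.single s 1) - Pi.single s 1 = p + Pi.single t 1 := by
      intro t
      rw [← add_assoc, add_tsub_cancel_right]
    simp only [shiftSum_apply, Fintype.sum_sum_type, Fintype.sum_prod_type, monomerDimerCoeff,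
      monomerDimerStep, Sum.elim_inl, Sum.elim_inr, AddMonoidHom.comp_apply,
      Pi.evalAddMonoidHom_apply, Nat.coe_castAddMonoidHom, Pi.add_apply, Pi.smul_apply,
      smul_eq_mul, Finset.sum_apply, Nat.cast_add, mul_add, add_mul, Finset.sum_add_distrib]
    have hsingle : ∀ t, ((Pi.single t 1 : S → ℕ) s : ℂ) = if s = t then 1 else 0 := by
      intro t
      rw [Pi.single_apply]
      split_ifs <;> simp
    simp only [hsingle, mul_ite, mul_one, mul_zero, ite_mul, zero_mul, Finset.sum_ite_eq,
      Finset.mem_univ, if_true, add_tsub_cancel_right]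
    rw [Finset.sum_comm]
    simp only [Finset.sum_ite_eq, Finset.mem_univ, if_true, h1, h2, hw _ s]
    rw [← Finset.sum_add_distrib]
    congr 1
    exact Finset.sum_congr rfl fun t _ => by ring
  rw [hfun] at hder
  refine Eq.trans ?_ (hder.trans ?_)
  · rfl
  · refine (expShift_add (C := ‖x s‖ * C) (D := ∑ t, ‖(w s t : ℂ)‖ * C) _ _ ?_ ?_).trans
      (congrArg₂ (· + ·) (expShift_smul _ _ _ _)
        ((expShift_sum (C := fun t => ‖(w s t : ℂ)‖ * C) _ _ _ ?_).trans
          (Finset.sum_congr rfl fun t _ => expShift_smul _ _ _ _)))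
    · intro p
      simp only [Pi.smul_apply, norm_smul]
      exact mul_le_mul_of_nonneg_left (hf _) (norm_nonneg _)
    · intro p
      simp only [Finset.sum_apply, Pi.smul_apply]
      refine norm_sum_le_of_le _ fun t _ => ?_
      rw [norm_smul]
      exact mul_le_mul_of_nonneg_left (hf _) (norm_nonneg _)
    · intro t p
      simp only [Pi.smul_apply, norm_smul]
      exact mul_le_mul_of_nonneg_left (hf _) (norm_nonneg _)

end Steps

lemma expShift_siteWeight_ne_zero {x : V × Bool → ℂ} {w : V × Bool → V × Bool → ℝ} {W : ℝ}
    (hx : ∀ s, 0 < (x s).re) (hw : ∀ s t, 0 ≤ w s t) (hsymm : ∀ s t, w s t = w t s) (hW : 0 ≤ W)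
    (m : V × Bool → ℕ) :
    expShift (monomerDimerCoeff x w) monomerDimerStep (siteWeight W m) ≠ 0 := by
  refine monomer_dimer_ne_zero
    (Z := fun m => expShift (monomerDimerCoeff x w) monomerDimerStep (siteWeight W m))
    (w := fun s t => w s t + if t = (s.1, !s.2) then W else 0) hx
    (fun s t => add_nonneg (hw s t) (by split_ifs <;> simp [hW])) ?_ (fun m s => ?_) m
  · have hz : shiftSum (monomerDimerCoeff x w) monomerDimerStep
        (siteWeight W (0 : V × Bool → ℕ)) = 0 := by
      ext p
      rw [shiftSum_apply]
      refine Finset.sum_eq_zero fun k _ => ?_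
      rw [siteWeight_zero, if_neg, mul_zero]
      rintro h
      rcases k with s | ⟨s, t⟩ <;> simpa [monomerDimerStep] using congrFun h s
    have hval : expShift (monomerDimerCoeff x w) monomerDimerStep
        (siteWeight W (0 : V × Bool → ℕ)) = 1 := by
      rw [expShift, tsum_eq_single 0]
      · simp [siteWeight_zero]
      · intro j hj
        obtain ⟨i, rfl⟩ := Nat.exists_eq_succ_of_ne_zero hj
        rw [Nat.succ_eq_add_one, pow_succ, Module.End.mul_apply, hz]
        simp
    simp only [hval]
    exact one_ne_zero
  · obtain ⟨C, hC⟩ := exists_norm_siteWeight_le W m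
    obtain ⟨C₁, hC₁⟩ := exists_norm_siteWeight_le W (m + Pi.single s 1)
    obtain ⟨C₂, hC₂⟩ := exists_norm_siteWeight_le W (m - Pi.single (s.1, !s.2) 1)
    have hrec : siteWeight W (m + Pi.single s 1) =
        (fun p : V × Bool → ℕ => (p s : ℂ) * siteWeight W m (p - Pi.single s 1)) +
          (W * m (s.1, !s.2) : ℂ) • siteWeight W (m - Pi.single (s.1, !s.2) 1) := by
      ext p
      exact siteWeight_add_single_points W m p s
    have hb₂ : ∀ p, ‖((W * m (s.1, !s.2) : ℂ) • siteWeight W (m - Pi.single (s.1, !s.2) 1)) p‖ ≤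
        ‖(W * m (s.1, !s.2) : ℂ)‖ * C₂ := by
      intro p
      rw [Pi.smul_apply, norm_smul]
      exact mul_le_mul_of_nonneg_left (hC₂ p) (norm_nonneg _)
    have hb₁ : ∀ p : V × Bool → ℕ, ‖(p s : ℂ) * siteWeight W m (p - Pi.single s 1)‖ ≤
        C₁ + ‖(W * m (s.1, !s.2) : ℂ)‖ * C₂ := by
      intro p
      have h := congrFun hrec p
      rw [Pi.add_apply, ← sub_eq_iff_eq_add] at h
      rw [← h]
      exact (norm_sub_le _ _).trans (add_le_add (hC₁ p) (hb₂ p))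
    have hadd : ∀ t, (fun p : V × Bool → ℕ => siteWeight W m (p + Pi.single t 1)) =
        (m t : ℂ) • siteWeight W (m - Pi.single t 1) := fun t => by
      ext p
      exact siteWeight_add_single W m p t
    rw [hrec, expShift_add _ _ hb₁ hb₂, expShift_smul, expShift_pi_single_mul x hsymm s hC,
      add_assoc]
    congr 1
    simp only [hadd, expShift_smul]
    push_cast
    simp only [add_mul, Finset.sum_add_distrib, ← mul_assoc]
    congr 1
    simp [apply_ite]

end MonomerDimer

section XYModel

open Filter Topology

variable {V : Type*} [Fintype V]

/-- The monomial `∏ v, w_v ^ p (v, true) * conj w_v ^ p (v, false)` at `w_v = exp (i θ_v)`. -/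
noncomputable def angleCharacter (θ : V → ℝ) (p : V × Bool → ℕ) : ℂ :=
  ∏ v, Complex.exp (((p (v, true) : ℂ) - p (v, false)) * (θ v * Complex.I))

/-- The normalized integral over the torus of the monomial with exponent `p`. -/
noncomputable def torusWeight (p : V × Bool → ℕ) : ℂ :=
  ∏ v, if p (v, true) = p (v, false) then 1 else 0

lemma angleCharacter_zero (θ : V → ℝ) : angleCharacter θ 0 = 1 := by
  simp [angleCharacter]

lemma angleCharacter_add (θ : V → ℝ) (p q : V × Bool → ℕ) :
    angleCharacter θ (p + q) = angleCharacter θ p * angleCharacter θ q := by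
  simp only [angleCharacter, ← Finset.prod_mul_distrib, ← Complex.exp_add, Pi.add_apply]
  refine Finset.prod_congr rfl fun v _ => ?_
  push_cast
  ring_nf

lemma angleCharacter_single [DecidableEq V] (θ : V → ℝ) (v : V) (b : Bool) :
    angleCharacter θ (Pi.single (v, b) 1) =
      Complex.exp ((if b then 1 else -1) * (θ v * Complex.I)) := by
  rw [angleCharacter, Finset.prod_eq_single v]
  · cases b <;> simp
  · intro u _ hu
    simp [hu]
  · simp

lemma norm_angleCharacter (θ : V → ℝ) (p : V × Bool → ℕ) : ‖angleCharacter θ p‖ = 1 := by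
  rw [angleCharacter, norm_prod]
  refine Finset.prod_eq_one fun v _ => ?_
  have : ((p (v, true) : ℂ) - p (v, false)) * (θ v * Complex.I) =
      ((((p (v, true) : ℝ) - p (v, false)) * θ v : ℝ) : ℂ) * Complex.I := by
    push_cast
    ring
  rw [this, Complex.norm_exp_ofReal_mul_I]

lemma continuous_angleCharacter (p : V × Bool → ℕ) :
    Continuous fun θ : V → ℝ => angleCharacter θ p := by
  unfold angleCharacter
  fun_prop

lemma norm_torusWeight_le (p : V × Bool → ℕ) : ‖torusWeight p‖ ≤ 1 := by
  rw [torusWeight, norm_prod]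
  refine Finset.prod_le_one (fun _ _ => norm_nonneg _) fun v _ => ?_
  split_ifs <;> simp

lemma integral_exp_int_mul_angle (n : ℤ) :
    ∫ t in Set.Ioc (-π) π, Complex.exp (n * (t * Complex.I)) =
      if n = 0 then 2 * (π : ℂ) else 0 := by
  rw [← intervalIntegral.integral_of_le (by linarith [Real.pi_pos])]
  split_ifs with h
  · simp only [h, Int.cast_zero, zero_mul, Complex.exp_zero, intervalIntegral.integral_const,
      Complex.real_smul]
    push_cast
    ring
  · have hn : (n : ℂ) * Complex.I ≠ 0 := mul_ne_zero (by exact_mod_cast h) Complex.I_ne_zero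
    have h1 : ∀ t : ℝ, (n : ℂ) * (t * Complex.I) = n * Complex.I * t := fun t => by ring
    simp only [h1]
    rw [integral_exp_mul_complex hn, div_eq_zero_iff, sub_eq_zero]
    left
    rw [Complex.exp_eq_exp_iff_exists_int]
    refine ⟨n, ?_⟩
    push_cast
    ring

lemma integral_angleCharacter (p : V × Bool → ℕ) :
    ∫ θ, angleCharacter θ p ∂(Measure.pi fun _ : V => volume.restrict (Set.Ioc (-π) π)) =
      (2 * π : ℂ) ^ Fintype.card V * torusWeight p := by
  have h := integral_fintype_prod_eq_prod
    (μ := fun _ : V => (volume : Measure ℝ).restrict (Set.Ioc (-π) π))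
    (fun (v : V) (t : ℝ) =>
      Complex.exp (((p (v, true) : ℂ) - p (v, false)) * (t * Complex.I)))
  refine h.trans ?_
  rw [torusWeight, Fintype.card, ← Finset.prod_const, ← Finset.prod_mul_distrib]
  refine Finset.prod_congr rfl fun v _ => ?_
  have h2 := integral_exp_int_mul_angle ((p (v, true) : ℤ) - p (v, false))
  push_cast at h2
  rw [h2]
  simp only [sub_eq_zero, Nat.cast_inj, mul_ite, mul_one, mul_zero]

lemma sum_sum_sym2_mk [DecidableEq V] {E : Finset (Sym2 V)} (hE : ∀ e ∈ E, ¬ e.IsDiag)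
    (g : Sym2 V → ℝ) :
    ∑ u, ∑ v, (if s(u, v) ∈ E then g s(u, v) else 0) = ∑ e ∈ E, 2 * g e := by
  have h1 : ∀ u v, (if s(u, v) ∈ E then g s(u, v) else 0) =
      ∑ e ∈ E, if s(u, v) = e then g e else 0 := by
    intro u v
    rw [Finset.sum_ite_eq]
  simp only [h1]
  rw [← Fintype.sum_prod_type' (fun u v => ∑ e ∈ E, if s(u, v) = e then g e else 0),
    Finset.sum_comm]
  refine Finset.sum_congr rfl fun e he => ?_
  have hd := hE e he
  induction e using Sym2.ind with
  | _ a b =>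
    rw [Sym2.mk_isDiag_iff] at hd
    rw [← Finset.sum_filter, Finset.sum_const]
    have : (Finset.univ.filter fun x : V × V => s(x.1, x.2) = s(a, b)) = {(a, b), (b, a)} := by
      ext ⟨u, v⟩
      simp
    rw [this, Finset.card_pair (by simp [hd]), nsmul_eq_mul, Nat.cast_two]

/-- The pair interaction of the XY model between the variables `w_u` and `conj w_v`. -/
noncomputable def xyCoupling [DecidableEq V] (E : Finset (Sym2 V)) (J : Sym2 V → ℝ)
    (s t : V × Bool) : ℝ :=
  if s.2 = t.2 then 0 else if s(s.1, t.1) ∈ E then J s(s.1, t.1) / 2 else 0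

/-- The field of the XY model acting on `w_v` and `conj w_v`. -/
noncomputable def xyField (lam : V → ℝ) (z : ℂ) (s : V × Bool) : ℂ := z * lam s.1 / 2

lemma sum_monomerDimerCoeff_mul_angleCharacter [DecidableEq V] {E : Finset (Sym2 V)}
    (hE : ∀ e ∈ E, ¬ e.IsDiag) (J : Sym2 V → ℝ) (lam : V → ℝ) (z : ℂ) (θ : V → ℝ) :
    ∑ k, monomerDimerCoeff (xyField lam z) (xyCoupling E J) k *
        angleCharacter θ (monomerDimerStep k) =
      ((∑ e ∈ E, J e * xyEdgeCos θ e : ℝ) : ℂ) +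
        z * ((∑ v, lam v * Real.cos (θ v) : ℝ) : ℂ) := by
  have hcos : ∀ t : ℝ, (Real.cos t : ℂ) =
      (Complex.exp (t * Complex.I) + Complex.exp (-(t * Complex.I))) / 2 := by
    intro t
    rw [Complex.ofReal_cos, Complex.cos, neg_mul]
  rw [Fintype.sum_sum_type, add_comm]
  congr 1
  · have h1 : ∑ e ∈ E, J e * xyEdgeCos θ e =
        ∑ u, ∑ v, if s(u, v) ∈ E then J s(u, v) / 2 * Real.cos (θ u - θ v) else 0 := by
      refine Eq.trans ?_ (sum_sum_sym2_mk hE fun e => J e / 2 * xyEdgeCos θ e).symm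
      exact Finset.sum_congr rfl fun e _ => by ring
    rw [h1]
    push_cast
    simp only [Fintype.sum_prod_type, Fintype.sum_bool, ← Finset.sum_add_distrib]
    refine Finset.sum_congr rfl fun u _ => Finset.sum_congr rfl fun v _ => ?_
    simp only [monomerDimerCoeff, monomerDimerStep, Sum.elim_inr, xyCoupling,
      angleCharacter_add, angleCharacter_single]
    by_cases h : s(u, v) ∈ E
    · have h2 := hcos (θ u - θ v)
      push_cast at h2
      simp only [h, if_true, ← Complex.exp_add]
      push_cast
      rw [h2]
      simp
      ring_nf
    · simp [h]
  · push_cast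
    rw [Fintype.sum_prod_type, Finset.mul_sum]
    refine Finset.sum_congr rfl fun v _ => ?_
    have h2 := hcos (θ v)
    push_cast at h2
    rw [Fintype.sum_bool, h2]
    simp only [monomerDimerCoeff, monomerDimerStep, Sum.elim_inl, xyField, angleCharacter_single]
    simp
    ring

lemma integral_xy_eq_expShift [DecidableEq V] {E : Finset (Sym2 V)}
    (hE : ∀ e ∈ E, ¬ e.IsDiag) (J : Sym2 V → ℝ) (lam : V → ℝ) (z : ℂ) :
    (∫ θ : V → ℝ,
        Complex.exp ((∑ e ∈ E, J e * xyEdgeCos θ e : ℝ) : ℂ) *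
          Complex.exp (z * ((∑ v, lam v * Real.cos (θ v) : ℝ) : ℂ))
        ∂(Measure.pi fun _ : V => volume.restrict (Set.Ioc (-π) π))) =
      (2 * π : ℂ) ^ Fintype.card V *
        expShift (monomerDimerCoeff (xyField lam z) (xyCoupling E J)) monomerDimerStep
          torusWeight := by
  have h := integral_expShift (Measure.pi fun _ : V => volume.restrict (Set.Ioc (-π) π))
    (monomerDimerCoeff (xyField lam z) (xyCoupling E J)) monomerDimerStep
    (f := angleCharacter) (C := 1)
    (fun p => .of_bound (continuous_angleCharacter p).aestronglyMeasurable 1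
      (.of_forall fun θ => (norm_angleCharacter θ p).le))
    (fun θ p => (norm_angleCharacter θ p).le)
  have h2 : (fun p => ∫ θ, angleCharacter θ p
      ∂(Measure.pi fun _ : V => volume.restrict (Set.Ioc (-π) π))) =
      ((2 * π : ℂ) ^ Fintype.card V) • torusWeight := funext integral_angleCharacter
  rw [h2, expShift_smul] at h
  rw [← h]
  refine integral_congr_ae (.of_forall fun θ => ?_)
  simp only
  rw [expShift_character _ _ (angleCharacter_add θ) (angleCharacter_zero θ),
    sum_monomerDimerCoeff_mul_angleCharacter hE, Complex.exp_add]

lemma integral_xy_one_ne_zero (E : Finset (Sym2 V)) (J : Sym2 V → ℝ) (lam : V → ℝ) :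
    (∫ θ : V → ℝ,
        Complex.exp ((∑ e ∈ E, J e * xyEdgeCos θ e : ℝ) : ℂ) *
          Complex.exp (1 * ((∑ v, lam v * Real.cos (θ v) : ℝ) : ℂ))
        ∂(Measure.pi fun _ : V => volume.restrict (Set.Ioc (-π) π))) ≠ 0 := by
  have hedge : ∀ e : Sym2 V, Continuous (fun θ : V → ℝ => xyEdgeCos θ e) ∧
      ∀ θ : V → ℝ, |xyEdgeCos θ e| ≤ 1 := by
    intro e
    induction e using Sym2.ind with
    | _ a b =>
      refine ⟨?_, fun θ => Real.abs_cos_le_one _⟩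
      change Continuous fun θ : V → ℝ => Real.cos (θ a - θ b)
      fun_prop
  let H : (V → ℝ) → ℝ := fun θ =>
    ∑ e ∈ E, J e * xyEdgeCos θ e + ∑ v, lam v * Real.cos (θ v)
  have hH : Continuous H :=
    (continuous_finsetSum _ fun e _ => continuous_const.mul (hedge e).1).add
      (continuous_finsetSum _ fun v _ => by fun_prop)
  have hHle : ∀ θ, H θ ≤ ∑ e ∈ E, |J e| + ∑ v, |lam v| := by
    intro θ
    refine add_le_add (Finset.sum_le_sum fun e _ => ?_) (Finset.sum_le_sum fun v _ => ?_)
    · refine (le_abs_self _).trans ?_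
      rw [abs_mul]
      exact mul_le_of_le_one_right (abs_nonneg _) ((hedge e).2 θ)
    · refine (le_abs_self _).trans ?_
      rw [abs_mul]
      exact mul_le_of_le_one_right (abs_nonneg _) (Real.abs_cos_le_one _)
  have hint : Integrable (fun θ => Real.exp (H θ))
      (Measure.pi fun _ : V => (volume : Measure ℝ).restrict (Set.Ioc (-π) π)) := by
    refine .of_bound (Real.continuous_exp.comp hH).aestronglyMeasurable
      (Real.exp (∑ e ∈ E, |J e| + ∑ v, |lam v|)) (.of_forall fun θ => ?_)
    rw [Real.norm_eq_abs, Real.abs_exp]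
    exact Real.exp_le_exp.2 (hHle θ)
  have : NeZero (Measure.pi fun _ : V => (volume : Measure ℝ).restrict (Set.Ioc (-π) π)) := by
    refine ⟨fun h => ?_⟩
    have h1 := congrArg (fun μ => μ Set.univ) h
    simp only [Measure.pi_univ, Measure.restrict_apply_univ, Real.volume_Ioc,
      Measure.coe_zero, Pi.zero_apply, Finset.prod_eq_zero_iff, ENNReal.ofReal_eq_zero] at h1
    obtain ⟨_, _, h2⟩ := h1
    linarith [Real.pi_pos]
  have hpos := integral_exp_pos hint
  have heq : ∀ θ : V → ℝ, Complex.exp ((∑ e ∈ E, J e * xyEdgeCos θ e : ℝ) : ℂ) *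
      Complex.exp (1 * ((∑ v, lam v * Real.cos (θ v) : ℝ) : ℂ)) =
      ((Real.exp (H θ) : ℝ) : ℂ) := by
    intro θ
    rw [← Complex.exp_add, one_mul, ← Complex.ofReal_add, Complex.ofReal_exp]
  simp only [heq]
  rw [integral_complex_ofReal]
  exact_mod_cast hpos.ne'

/-- The site weights with `N` points in each family, normalized to equal `1` at `0`. -/
noncomputable def normalizedSiteWeight (N : ℕ) (p : V × Bool → ℕ) : ℂ :=
  (((N.factorial : ℂ) * (N : ℂ) ^ N) ^ Fintype.card V)⁻¹ * siteWeight N (fun _ => N) p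

lemma normalizedSiteWeight_eq {N : ℕ} (hN : N ≠ 0) (p : V × Bool → ℕ) :
    normalizedSiteWeight N p = ∏ v, if p (v, true) = p (v, false) then
      ((N.descFactorial (p (v, true)) / (N : ℝ) ^ p (v, true) : ℝ) : ℂ) else 0 := by
  rw [normalizedSiteWeight, siteWeight, mul_comm, ← div_eq_mul_inv, Fintype.card,
    ← Finset.prod_const, ← Finset.prod_div_distrib]
  exact Finset.prod_congr rfl fun v _ => pairWeight_div_self hN _ _

lemma norm_normalizedSiteWeight_le {N : ℕ} (hN : N ≠ 0) (p : V × Bool → ℕ) :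
    ‖normalizedSiteWeight N p‖ ≤ 1 := by
  rw [normalizedSiteWeight_eq hN, norm_prod]
  refine Finset.prod_le_one (fun _ _ => norm_nonneg _) fun v _ => ?_
  split_ifs
  · rw [Complex.norm_real, Real.norm_of_nonneg (by positivity)]
    exact div_le_one_of_le₀ (by exact_mod_cast Nat.descFactorial_le_pow _ _) (by positivity)
  · simp

lemma tendsto_normalizedSiteWeight (p : V × Bool → ℕ) :
    Tendsto (fun N : ℕ => normalizedSiteWeight N p) atTop (𝓝 (torusWeight p)) := by
  have h : Tendsto (fun N : ℕ => ∏ v, if p (v, true) = p (v, false) then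
      ((N.descFactorial (p (v, true)) / (N : ℝ) ^ p (v, true) : ℝ) : ℂ) else 0) atTop
      (𝓝 (torusWeight p)) := by
    refine tendsto_finsetProd _ fun v _ => ?_
    split_ifs
    · exact_mod_cast (Complex.continuous_ofReal.tendsto 1).comp
        (tendsto_descFactorial_div_pow (p (v, true)))
    · exact tendsto_const_nhds
  refine h.congr' ?_
  filter_upwards [eventually_ne_atTop 0] with N hN
  exact (normalizedSiteWeight_eq hN p).symm

omit [Fintype V] in
lemma xyCoupling_comm [DecidableEq V] (E : Finset (Sym2 V)) (J : Sym2 V → ℝ) (s t : V × Bool) :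
    xyCoupling E J s t = xyCoupling E J t s := by
  unfold xyCoupling
  rw [Sym2.eq_swap]
  simp only [eq_comm]

omit [Fintype V] in
lemma xyCoupling_nonneg [DecidableEq V] {E : Finset (Sym2 V)} {J : Sym2 V → ℝ}
    (hJ : ∀ e ∈ E, 0 ≤ J e) (s t : V × Bool) : 0 ≤ xyCoupling E J s t := by
  unfold xyCoupling
  split_ifs with _ h
  · exact le_rfl
  · exact div_nonneg (hJ _ h) zero_le_two
  · exact le_rfl

omit [Fintype V] in
lemma differentiable_monomerDimerCoeff_xyField [DecidableEq V] (E : Finset (Sym2 V))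
    (J : Sym2 V → ℝ) (lam : V → ℝ) (k : (V × Bool) ⊕ (V × Bool) × (V × Bool)) :
    Differentiable ℂ fun z => monomerDimerCoeff (xyField lam z) (xyCoupling E J) k := by
  rcases k with s | e
  · simp only [monomerDimerCoeff, Sum.elim_inl, xyField]
    fun_prop
  · simp [monomerDimerCoeff]

lemma expShift_normalizedSiteWeight_ne_zero [DecidableEq V] {E : Finset (Sym2 V)}
    {J : Sym2 V → ℝ} (hJ : ∀ e ∈ E, 0 ≤ J e) {lam : V → ℝ} (hlam : ∀ v, 0 < lam v)
    {N : ℕ} (hN : N ≠ 0) {z : ℂ} (hz : 0 < z.re) :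
    expShift (monomerDimerCoeff (xyField lam z) (xyCoupling E J)) monomerDimerStep
      (normalizedSiteWeight N) ≠ 0 := by
  have hsmul : (normalizedSiteWeight N : (V × Bool → ℕ) → ℂ) =
      (((N.factorial : ℂ) * (N : ℂ) ^ N) ^ Fintype.card V)⁻¹ • siteWeight N (fun _ => N) := rfl
  rw [hsmul, expShift_smul]
  refine mul_ne_zero ?_ (expShift_siteWeight_ne_zero (fun s => ?_) (xyCoupling_nonneg hJ)
    (xyCoupling_comm E J) N.cast_nonneg _)
  · have : (N : ℂ) ≠ 0 := by exact_mod_cast hN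
    have : (N.factorial : ℂ) ≠ 0 := by exact_mod_cast N.factorial_ne_zero
    positivity
  · have : xyField lam z s = ((lam s.1 / 2 : ℝ) : ℂ) * z := by
      rw [xyField]
      push_cast
      ring
    rw [this, Complex.re_ofReal_mul]
    exact mul_pos (half_pos (hlam _)) hz

lemma expShift_torusWeight_ne_zero [DecidableEq V] {E : Finset (Sym2 V)}
    (hE : ∀ e ∈ E, ¬ e.IsDiag) {J : Sym2 V → ℝ} (hJ : ∀ e ∈ E, 0 ≤ J e) {lam : V → ℝ}
    (hlam : ∀ v, 0 ≤ lam v) {z : ℂ} (hz : 0 < z.re) :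
    expShift (monomerDimerCoeff (xyField lam z) (xyCoupling E J)) monomerDimerStep
      torusWeight ≠ 0 := by
  have hopen : IsOpen {z : ℂ | 0 < z.re} := isOpen_lt continuous_const Complex.continuous_re
  refine ne_zero_of_tendstoLocallyUniformlyOn hopen
    (convex_halfSpace_re_gt 0).isPreconnected
    (F := fun N z => expShift
      (monomerDimerCoeff (xyField (fun v => lam v + 1 / ((N : ℝ) + 1)) z) (xyCoupling E J))
      monomerDimerStep (normalizedSiteWeight N))
    (f := fun z => expShift (monomerDimerCoeff (xyField lam z) (xyCoupling E J))
      monomerDimerStep torusWeight) ?_ ?_ ?_ (x := 1) (by simp) ?_ hz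
  · filter_upwards [eventually_ne_atTop 0] with N hN
    exact (differentiable_expShift _ (differentiable_monomerDimerCoeff_xyField E J _)
      (norm_normalizedSiteWeight_le hN)).differentiableOn
  · rw [hopen.tendstoLocallyUniformlyOn_iff_forall_tendsto]
    intro z₀ _
    have hlimit : Tendsto (fun y : ℕ × ℂ => expShift
        (monomerDimerCoeff (xyField (fun v => lam v + 1 / ((y.1 : ℝ) + 1)) y.2) (xyCoupling E J))
        monomerDimerStep (normalizedSiteWeight y.1)) (atTop ×ˢ 𝓝 z₀)
        (𝓝 (expShift (monomerDimerCoeff (xyField lam z₀) (xyCoupling E J)) monomerDimerStep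
          torusWeight)) := by
      refine tendsto_expShift (C := 1) _ (fun k => ?_)
        (fun p => (tendsto_normalizedSiteWeight p).comp tendsto_fst) ?_
      · rcases k with s | e
        · simp only [monomerDimerCoeff, Sum.elim_inl, xyField]
          have h1 : Tendsto (fun y : ℕ × ℂ => (1 / ((y.1 : ℝ) + 1) : ℝ)) (atTop ×ˢ 𝓝 z₀) (𝓝 0) :=
            tendsto_one_div_add_atTop_nhds_zero_nat.comp tendsto_fst
          have h2 : Tendsto (fun y : ℕ × ℂ => ((lam s.1 + 1 / ((y.1 : ℝ) + 1) : ℝ) : ℂ))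
              (atTop ×ˢ 𝓝 z₀) (𝓝 (lam s.1 : ℂ)) := by
            have := (Complex.continuous_ofReal.tendsto (lam s.1 + 0)).comp (h1.const_add (lam s.1))
            simpa only [add_zero, Function.comp_def] using this
          exact (tendsto_snd.mul h2).div_const 2
        · exact tendsto_const_nhds
      · filter_upwards [tendsto_fst.eventually (eventually_ne_atTop 0)] with y hy
        exact norm_normalizedSiteWeight_le hy
    have hcont : Tendsto (fun y : ℕ × ℂ => expShift
        (monomerDimerCoeff (xyField lam y.2) (xyCoupling E J)) monomerDimerStep torusWeight)
        (atTop ×ˢ 𝓝 z₀) (𝓝 (expShift (monomerDimerCoeff (xyField lam z₀) (xyCoupling E J))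
          monomerDimerStep torusWeight)) :=
      ((differentiable_expShift monomerDimerStep
        (differentiable_monomerDimerCoeff_xyField E J lam)
        norm_torusWeight_le).continuous.tendsto z₀).comp tendsto_snd
    exact (hcont.prodMk_nhds hlimit).mono_right (nhds_le_uniformity _)
  · filter_upwards [eventually_ne_atTop 0] with N hN z hz
    exact expShift_normalizedSiteWeight_ne_zero hJ
      (fun v => add_pos_of_nonneg_of_pos (hlam v) Nat.one_div_pos_of_nat) hN hz
  · have h := integral_xy_one_ne_zero E J lam
    rw [integral_xy_eq_expShift hE] at h
    exact right_ne_zero_of_mul h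

lemma expShift_torusWeight_neg [DecidableEq V] (E : Finset (Sym2 V)) (J : Sym2 V → ℝ)
    (lam : V → ℝ) (z : ℂ) :
    expShift (monomerDimerCoeff (xyField lam (-z)) (xyCoupling E J)) monomerDimerStep
        torusWeight =
      expShift (monomerDimerCoeff (xyField lam z) (xyCoupling E J)) monomerDimerStep
        torusWeight := by
  let σ : (V × Bool → ℕ) → ℂ := fun p => (-1) ^ ∑ s, p s
  have hσ : ∀ p q, σ (p + q) = σ p * σ q := fun p q => by
    simp [σ, Finset.sum_add_distrib, pow_add]
  have hmul : σ * torusWeight = torusWeight := by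
    ext p
    by_cases h : ∀ v, p (v, true) = p (v, false)
    · have : Even (∑ s, p s) := by
        rw [Fintype.sum_prod_type]
        refine Finset.even_sum _ fun v _ => ?_
        rw [Fintype.sum_bool, h]
        exact ⟨_, rfl⟩
      simp [σ, this.neg_one_pow]
    · push Not at h
      obtain ⟨v, hv⟩ := h
      have : torusWeight p = 0 := Finset.prod_eq_zero (Finset.mem_univ v) (if_neg hv)
      simp [this]
  have h := expShift_sign_mul (monomerDimerCoeff (xyField lam z) (xyCoupling E J))
    monomerDimerStep hσ (by simp [σ]) torusWeight
  rw [hmul] at h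
  rw [h]
  congr 1
  ext k
  have hs : ∀ s : V × Bool, σ (Pi.single s 1) = -1 := fun s => by simp [σ]
  rcases k with s | e
  · simp only [monomerDimerCoeff, monomerDimerStep, Sum.elim_inl, hs, xyField]
    ring
  · simp [monomerDimerCoeff, monomerDimerStep, hσ, hs]

end XYModel

/-- Lee–Yang theorem for the XY model: on a finite graph `(V, E)` with ferromagnetic
couplings `J_e ≥ 0` and nonnegative weights `λ_v ≥ 0`, the (unnormalized) moment
generating function of `∑_v λ_v cos θ_v` has only pure imaginary zeros. -/
theorem xy_model_lee_yang {V : Type*} [Fintype V] [DecidableEq V]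
    (E : Finset (Sym2 V)) (hE : ∀ e ∈ E, ¬ e.IsDiag)
    (J : Sym2 V → ℝ) (hJ : ∀ e ∈ E, 0 ≤ J e)
    (lam : V → ℝ) (hlam : ∀ v, 0 ≤ lam v)
    (z : ℂ) (hz : z.re ≠ 0) :
    (∫ θ : V → ℝ,
        Complex.exp ((∑ e ∈ E, J e * xyEdgeCos θ e : ℝ) : ℂ) *
          Complex.exp (z * ((∑ v, lam v * Real.cos (θ v) : ℝ) : ℂ))
        ∂(Measure.pi fun _ : V => volume.restrict (Set.Ioc (-π) π))) ≠ 0 := by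
  rw [integral_xy_eq_expShift hE]
  have hpi : (π : ℂ) ≠ 0 := Complex.ofReal_ne_zero.2 Real.pi_ne_zero
  refine mul_ne_zero (pow_ne_zero _ (mul_ne_zero two_ne_zero hpi)) ?_
  rcases hz.lt_or_gt with h | h
  · rw [← expShift_torusWeight_neg]
    exact expShift_torusWeight_ne_zero hE hJ hlam (by simpa using h)
  · exact expShift_torusWeight_ne_zero hE hJ hlam h
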